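/- Rate of convergence of the Euler scheme: Let α, β ∈ (0,1) with α(1+β) > 1, A ∈ C^α_t C^{1+β}_V and x₀ ∈ V. For n ≥ 1 set t^n_k := kT/n (k = 0,…,n) and define the n-step Euler path x^n : [0,T] → V by x^n_0 = x₀ and x^n_t := x^n_{t^n_k} + A(t, x^n_{t^n_k}) − A(t^n_k, x^n_{t^n_k}) for t ∈ [t^n_k, t^n_{k+1}]. Let x ∈ C^α([0,T];V) be the unique solution of the YDE x_t = x₀ + ∫_0^t A(ds,x_s). Then there exists C = C(α,β,T) such that ‖x − x^n‖_α ≤ C exp(C ‖A‖_{α,1+β}^6) n^{1−2α} for all n ≥ 1. -/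

import Mathlib

/-- The constant of the discrete sewing lemma with exponent `θ > 1`. -/
noncomputable def sewingConst (θ : ℝ) : ℝ := (1 - (2 / 3 : ℝ) ^ (θ - 1))⁻¹

lemma two_thirds_rpow_lt_one {θ : ℝ} (hθ : 1 < θ) : (2 / 3 : ℝ) ^ (θ - 1) < 1 :=
  Real.rpow_lt_one (by norm_num) (by norm_num) (by linarith)

lemma sewingConst_pos {θ : ℝ} (hθ : 1 < θ) : 0 < sewingConst θ :=
  inv_pos.2 (by linarith [two_thirds_rpow_lt_one hθ])

lemma sewingConst_mul_add_one {θ : ℝ} (hθ : 1 < θ) :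
    sewingConst θ * (2 / 3 : ℝ) ^ (θ - 1) + 1 = sewingConst θ := by
  have h : (1 - (2 / 3 : ℝ) ^ (θ - 1)) ≠ 0 := by linarith [two_thirds_rpow_lt_one hθ]
  unfold sewingConst
  field_simp
  ring

/-- Splitting `[0, m + n]` into two pieces of comparable size gains a factor `(2/3)^(θ-1)`. -/
lemma rpow_add_rpow_le_two_thirds {θ m n : ℝ} (hθ : 1 < θ) (hm : 0 < m) (hn : 0 < n)
    (hmn : m ≤ 2 * n) (hnm : n ≤ 2 * m) :
    m ^ θ + n ^ θ ≤ (2 / 3 : ℝ) ^ (θ - 1) * (m + n) ^ θ := by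
  have key : ∀ k : ℝ, 0 < k → 3 * k ≤ 2 * (m + n) →
      k ^ θ ≤ k * ((2 / 3 : ℝ) ^ (θ - 1) * (m + n) ^ (θ - 1)) := by
    intro k hk hk'
    rw [← Real.mul_rpow (by norm_num) (by positivity)]
    calc k ^ θ = k * k ^ (θ - 1) := by
          rw [← Real.rpow_one_add' hk.le (by linarith)]; congr 1; ring
      _ ≤ _ := by gcongr; linarith
  calc m ^ θ + n ^ θ ≤ m * ((2 / 3 : ℝ) ^ (θ - 1) * (m + n) ^ (θ - 1))
        + n * ((2 / 3 : ℝ) ^ (θ - 1) * (m + n) ^ (θ - 1)) :=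
        add_le_add (key m hm (by linarith)) (key n hn (by linarith))
    _ = (2 / 3 : ℝ) ^ (θ - 1) * ((m + n) * (m + n) ^ (θ - 1)) := by ring
    _ = _ := by
        rw [← Real.rpow_one_add' (by positivity) (by linarith)]; congr 2; ring

/-- Discrete sewing lemma. -/
theorem discrete_sewing {V : Type*} [SeminormedAddCommGroup V] {θ a b : ℝ} (hθ : 1 < θ)
    (ha : 0 ≤ a) {N : ℕ} (hN : 1 ≤ N) (R : ℕ → ℕ → V)
    (hb : ∀ i < N, ‖R i (i + 1)‖ ≤ b)
    (hδ : ∀ i k j, i < k → k < j → j ≤ N →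
      ‖R i j - R i k - R k j‖ ≤ a * ((j : ℝ) - i) ^ θ) :
    ‖R 0 N‖ ≤ N * b + sewingConst θ * a * (N : ℝ) ^ θ := by
  have hc := sewingConst_pos hθ
  suffices H : ∀ m, 1 ≤ m → ∀ i, i + m ≤ N →
      ‖R i (i + m)‖ ≤ m * b + sewingConst θ * a * (m : ℝ) ^ θ by
    simpa using H N hN 0 (by simp)
  intro m
  induction m using Nat.strong_induction_on with
  | _ m ih =>
    intro hm i hi
    rcases hm.eq_or_lt with rfl | hm2
    · have h1 := hb i (by omega)
      simp only [Nat.cast_one, one_mul, Real.one_rpow, mul_one]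
      nlinarith [mul_nonneg hc.le ha]
    obtain ⟨p, q, rfl, hp, hq, hpq, hqp⟩ :
        ∃ p q, m = p + q ∧ 1 ≤ p ∧ 1 ≤ q ∧ p ≤ 2 * q ∧ q ≤ 2 * p :=
      ⟨m / 2, m - m / 2, by omega, by omega, by omega, by omega, by omega⟩
    have h1 := ih p (by omega) hp i (by omega)
    have h2 := ih q (by omega) hq (i + p) (by omega)
    have h3 := hδ i (i + p) (i + (p + q)) (by omega) (by omega) hi
    rw [add_assoc] at h2
    have h4 := rpow_add_rpow_le_two_thirds (m := p) (n := q) hθ (by exact_mod_cast hp)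
      (by exact_mod_cast hq) (by exact_mod_cast hpq) (by exact_mod_cast hqp)
    have h5 : ‖R i (i + (p + q))‖ ≤ ‖R i (i + p)‖ + ‖R (i + p) (i + (p + q))‖
        + ‖R i (i + (p + q)) - R i (i + p) - R (i + p) (i + (p + q))‖ := by
      have : R i (i + (p + q)) = R i (i + p) + R (i + p) (i + (p + q))
        + (R i (i + (p + q)) - R i (i + p) - R (i + p) (i + (p + q))) := by abel
      conv_lhs => rw [this]
      exact norm_add₃_le
    push_cast at h3 ⊢
    rw [add_sub_cancel_left] at h3
    have h6 : sewingConst θ * a * ((p : ℝ) ^ θ + (q : ℝ) ^ θ) + a * ((p : ℝ) + q) ^ θ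
        ≤ sewingConst θ * a * ((p : ℝ) + q) ^ θ := by
      calc _ ≤ sewingConst θ * a * ((2 / 3 : ℝ) ^ (θ - 1) * ((p : ℝ) + q) ^ θ)
            + a * ((p : ℝ) + q) ^ θ := by gcongr
        _ = (sewingConst θ * (2 / 3 : ℝ) ^ (θ - 1) + 1) * a * ((p : ℝ) + q) ^ θ := by ring
        _ = _ := by rw [sewingConst_mul_add_one hθ]
    linarith

/-- A linear bound that improves from `L` to `q + L / 2` holds with the fixed point `2 * q`. -/
lemma le_two_mul_of_bootstrap {ι : Type*} {p : ι → Prop} {f g : ι → ℝ} {L₀ q : ℝ}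
    (hL₀ : 0 ≤ L₀) (hq : 0 ≤ q) (h₀ : ∀ i, p i → f i ≤ L₀ * g i)
    (hstep : ∀ L, 0 ≤ L → (∀ i, p i → f i ≤ L * g i) → ∀ i, p i → f i ≤ (q + L / 2) * g i) :
    ∀ i, p i → f i ≤ 2 * q * g i := by
  have H : ∀ n : ℕ, ∀ i, p i → f i ≤ (2 * q + (L₀ - 2 * q) * (1 / 2) ^ n) * g i := by
    intro n
    induction n with
    | zero => simpa using h₀
    | succ n ih =>
      intro i hi
      convert hstep _ ?_ ih i hi using 2
      · ring
      · have h1 : (1 / 2 : ℝ) ^ n ≤ 1 := pow_le_one₀ (by norm_num) (by norm_num)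
        have h2 : (0 : ℝ) ≤ (1 / 2 : ℝ) ^ n := by positivity
        nlinarith [mul_nonneg hq (sub_nonneg.2 h1), mul_nonneg hL₀ h2]
  intro i hi
  have hlim : Filter.Tendsto (fun n : ℕ => (2 * q + (L₀ - 2 * q) * (1 / 2 : ℝ) ^ n) * g i)
      Filter.atTop (nhds ((2 * q + (L₀ - 2 * q) * 0) * g i)) :=
    ((tendsto_const_nhds.add (tendsto_const_nhds.mul
      (tendsto_pow_atTop_nhds_zero_of_lt_one (by norm_num) (by norm_num))))).mul_const _
  simpa using ge_of_tendsto' hlim fun n => H n i hi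

lemma norm_sub_le_mul_of_step {V : Type*} [SeminormedAddCommGroup V] {y : ℕ → V} {N : ℕ} {B : ℝ}
    (hB : ∀ i < N, ‖y (i + 1) - y i‖ ≤ B) (i m : ℕ) (hm : i + m ≤ N) :
    ‖y (i + m) - y i‖ ≤ m * B := by
  induction m with
  | zero => simp
  | succ m ih =>
    have h1 := ih (by omega)
    have h2 := hB (i + m) (by omega)
    have h3 := norm_sub_le_norm_sub_add_norm_sub (y (i + (m + 1))) (y (i + m)) (y i)
    push_cast
    rw [← add_assoc] at h3 ⊢
    linarith

/-- A Hölder bound on intervals of length at most `T / N` gives one on `[0, T]`. -/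
lemma holder_of_local {V : Type*} [SeminormedAddCommGroup V] {f : ℝ → V} {α H T : ℝ} (hα : 0 < α)
    (hH : 0 ≤ H) {N : ℕ} (hN : 1 ≤ N)
    (hf : ∀ s t, 0 ≤ s → s ≤ t → t ≤ T → t - s ≤ T / N → ‖f t - f s‖ ≤ H * (t - s) ^ α)
    {s t : ℝ} (hs : 0 ≤ s) (hst : s ≤ t) (ht : t ≤ T) :
    ‖f t - f s‖ ≤ N * H * (t - s) ^ α := by
  have hN1 : (1 : ℝ) ≤ N := by exact_mod_cast hN
  set d := (t - s) / N with hd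
  have hd0 : 0 ≤ d := div_nonneg (sub_nonneg.2 hst) (by linarith)
  have hNd : N * d = t - s := by rw [hd]; field_simp
  have h1 := norm_sub_le_mul_of_step (y := fun k : ℕ => f (s + k * d)) (N := N)
    (B := H * d ^ α) (fun i hi => by
      have hi' : (i : ℝ) + 1 ≤ N := by exact_mod_cast hi
      have hid : 0 ≤ (i : ℝ) * d := by positivity
      have hid' : ((i : ℝ) + 1) * d ≤ N * d := by gcongr
      have e : s + ((i + 1 : ℕ) : ℝ) * d - (s + i * d) = d := by push_cast; ring
      have := hf (s + i * d) (s + ((i + 1 : ℕ) : ℝ) * d) (by linarith) (by linarith)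
        (by push_cast; linarith)
        (by rw [e, hd]; gcongr; linarith)
      rwa [e] at this) 0 N (by omega)
  simp only [Nat.zero_add, Nat.cast_zero, zero_mul, add_zero, hNd, add_sub_cancel] at h1
  calc _ ≤ _ := h1
    _ = N * H * d ^ α := by ring
    _ ≤ _ := by
      gcongr
      rw [hd]
      exact div_le_self (sub_nonneg.2 hst) hN1

/-- Hölder bounds inside the cells of a grid and between grid points combine. -/
lemma holder_of_cell_of_grid {V : Type*} [SeminormedAddCommGroup V] {f : ℝ → V}
    {α H₁ H₂ h T Δ : ℝ} (hα : 0 < α) (hH₁ : 0 ≤ H₁) (hH₂ : 0 ≤ H₂) (hh : 0 < h) {n : ℕ}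
    (hnT : n * h = T)
    (hcell : ∀ k < n, ∀ s t, (k : ℝ) * h ≤ s → s ≤ t → t ≤ ((k : ℝ) + 1) * h →
      ‖f t - f s‖ ≤ H₁ * (t - s) ^ α)
    (hgrid : ∀ i j : ℕ, i ≤ j → j ≤ n → ((j : ℝ) - i) * h ≤ Δ →
      ‖f (j * h) - f (i * h)‖ ≤ H₂ * (((j : ℝ) - i) * h) ^ α)
    {s t : ℝ} (hs : 0 ≤ s) (hst : s ≤ t) (ht : t ≤ T) (htΔ : t - s ≤ Δ) :
    ‖f t - f s‖ ≤ (2 * H₁ + H₂) * (t - s) ^ α := by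
  have hcell' : ∀ k : ℕ, ∀ s t, (k : ℝ) * h ≤ s → s ≤ t → t ≤ ((k : ℝ) + 1) * h → t ≤ T →
      ‖f t - f s‖ ≤ H₁ * (t - s) ^ α := by
    intro k s t hks hst htk htT
    rcases lt_or_ge k n with hk | hk
    · exact hcell k hk s t hks hst htk
    · have hk' : (n : ℝ) * h ≤ k * h := by gcongr
      have : s = t := by linarith
      rw [this, sub_self, norm_zero, sub_self]
      positivity
  have hloc : ∀ u, 0 ≤ u → ((⌊u / h⌋₊ : ℕ) : ℝ) * h ≤ u ∧ u ≤ ((⌊u / h⌋₊ : ℝ) + 1) * h := by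
    intro u hu
    exact ⟨(le_div_iff₀ hh).1 (Nat.floor_le (by positivity)),
      (div_le_iff₀ hh).1 (Nat.lt_floor_add_one _).le⟩
  obtain ⟨hi1, hi2⟩ := hloc s hs
  obtain ⟨hj1, hj2⟩ := hloc t (hs.trans hst)
  have hij : ⌊s / h⌋₊ ≤ ⌊t / h⌋₊ := Nat.floor_mono (by gcongr)
  generalize ⌊s / h⌋₊ = i at *
  generalize ⌊t / h⌋₊ = j at *
  have h0 : 0 ≤ t - s := sub_nonneg.2 hst
  have hp : 0 ≤ (t - s) ^ α := by positivity
  rcases hij.eq_or_lt with rfl | hij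
  · have := hcell' i s t hi1 hst hj2 ht
    nlinarith [mul_nonneg hH₁ hp, mul_nonneg hH₂ hp]
  have hij' : (i : ℝ) + 1 ≤ j := by exact_mod_cast hij
  have hijh : ((i : ℝ) + 1) * h ≤ j * h := by gcongr
  have hjn : j ≤ n := by
    have : (j : ℝ) * h ≤ n * h := by linarith
    exact_mod_cast le_of_mul_le_mul_right this hh
  have h1 := hcell' i s (((i : ℝ) + 1) * h) hi1 hi2 le_rfl (by linarith)
  have h2 := hgrid (i + 1) j hij hjn (by push_cast; linarith)
  have h3 := hcell' j (j * h) t le_rfl hj1 hj2 ht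
  push_cast at h2
  have g1 : H₁ * (((i : ℝ) + 1) * h - s) ^ α ≤ H₁ * (t - s) ^ α := by
    gcongr
    linarith
  have g2 : H₂ * (((j : ℝ) - (i + 1)) * h) ^ α ≤ H₂ * (t - s) ^ α := by
    have : 0 ≤ ((j : ℝ) - (i + 1)) * h := mul_nonneg (by linarith) hh.le
    gcongr
    linarith
  have g3 : H₁ * (t - j * h) ^ α ≤ H₁ * (t - s) ^ α := by
    have : 0 ≤ t - j * h := by linarith
    gcongr
    linarith
  have h4 := norm_sub_le_norm_sub_add_norm_sub (f t) (f (j * h)) (f s)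
  have h5 := norm_sub_le_norm_sub_add_norm_sub (f (j * h)) (f (((i : ℝ) + 1) * h)) (f s)
  linarith

/-- Growth of a sequence controlled on blocks of length `m`. -/
lemma norm_le_of_block_growth {V : Type*} [SeminormedAddCommGroup V] {E : ℕ → V} {n m : ℕ} {r : ℝ}
    (hr : 0 ≤ r) (hE0 : E 0 = 0)
    (hE : ∀ a k, k ≤ m → a + k ≤ n → ‖E (a + k)‖ ≤ 2 * ‖E a‖ + r) (p : ℕ) :
    ∀ i ≤ n, i ≤ p * m → ‖E i‖ ≤ 3 ^ p * r := by
  induction p with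
  | zero =>
    intro i _ hi
    obtain rfl : i = 0 := by omega
    simpa [hE0] using hr
  | succ p ih =>
    intro i hin hi
    rw [Nat.succ_mul] at hi
    have h3 : (1 : ℝ) ≤ 3 ^ p := one_le_pow₀ (by norm_num)
    have h4 : r ≤ 3 ^ p * r := le_mul_of_one_le_left hr h3
    rcases le_total i (p * m) with h | h
    · have := ih i hin h
      rw [pow_succ]
      linarith
    · have h1 := hE (p * m) (i - p * m) (by omega) (by omega)
      have h2 := ih (p * m) (by omega) le_rfl
      rw [Nat.add_sub_cancel' h] at h1
      rw [pow_succ]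
      linarith

/-- The regularity assumptions on the driver of a nonlinear Young equation. -/
structure IsYoungDriver {V : Type*} [NormedAddCommGroup V] [NormedSpace ℝ V]
    (A : ℝ → V → V) (DA : ℝ → V → (V →L[ℝ] V)) (M α β T : ℝ) : Prop where
  hasFDerivAt : ∀ t z, 0 ≤ t → t ≤ T → HasFDerivAt (A t) (DA t z) z
  norm_increment_le : ∀ s t z, 0 ≤ s → s ≤ t → t ≤ T → ‖A t z - A s z‖ ≤ M * (t - s) ^ α
  norm_deriv_le : ∀ s t z, 0 ≤ s → s ≤ t → t ≤ T → ‖DA t z - DA s z‖ ≤ M * (t - s) ^ α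
  norm_deriv_sub_le : ∀ s t z w, 0 ≤ s → s ≤ t → t ≤ T →
    ‖DA t z - DA s z - (DA t w - DA s w)‖ ≤ M * (t - s) ^ α * ‖z - w‖ ^ β

namespace IsYoungDriver

variable {V : Type*} [NormedAddCommGroup V] [NormedSpace ℝ V]
  {A : ℝ → V → V} {DA : ℝ → V → (V →L[ℝ] V)} {M α β T : ℝ}

lemma hasFDerivAt_sub (hA : IsYoungDriver A DA M α β T) {s t : ℝ} (hs : 0 ≤ s) (hst : s ≤ t)
    (ht : t ≤ T) (z : V) : HasFDerivAt (fun z => A t z - A s z) (DA t z - DA s z) z :=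
  (hA.hasFDerivAt t z (hs.trans hst) ht).sub (hA.hasFDerivAt s z hs (hst.trans ht))

lemma lipschitz (hA : IsYoungDriver A DA M α β T) {s t : ℝ} (hs : 0 ≤ s) (hst : s ≤ t)
    (ht : t ≤ T) (z w : V) :
    ‖A t z - A s z - (A t w - A s w)‖ ≤ M * (t - s) ^ α * ‖z - w‖ :=
  convex_univ.norm_image_sub_le_of_norm_hasFDerivWithin_le
    (fun v _ => (hA.hasFDerivAt_sub hs hst ht v).hasFDerivWithinAt)
    (fun v _ => hA.norm_deriv_le s t v hs hst ht) (Set.mem_univ w) (Set.mem_univ z)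

lemma four_point (hA : IsYoungDriver A DA M α β T) {s t : ℝ} (hs : 0 ≤ s) (hst : s ≤ t)
    (ht : t ≤ T) (x y x' y' : V) :
    ‖A t x' - A s x' - (A t y' - A s y') - (A t x - A s x - (A t y - A s y))‖
      ≤ M * (t - s) ^ α * (‖x' - y' - (x - y)‖ + ‖y' - y‖ ^ β * ‖x - y‖) := by
  have h1 := hA.lipschitz hs hst ht x' (x + (y' - y))
  have h2 : ‖A t (x + (y' - y)) - A s (x + (y' - y)) - (A t x - A s x)
      - (A t (y + (y' - y)) - A s (y + (y' - y)) - (A t y - A s y))‖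
      ≤ M * (t - s) ^ α * ‖y' - y‖ ^ β * ‖x - y‖ := by
    refine convex_univ.norm_image_sub_le_of_norm_hasFDerivWithin_le
      (f := fun z => A t (z + (y' - y)) - A s (z + (y' - y)) - (A t z - A s z))
      (f' := fun z => DA t (z + (y' - y)) - DA s (z + (y' - y)) - (DA t z - DA s z))
      (fun v _ => ?_) (fun v _ => ?_) (Set.mem_univ y) (Set.mem_univ x)
    · exact (((hasFDerivAt_comp_add_right (y' - y)).2
        (hA.hasFDerivAt_sub hs hst ht (v + (y' - y)))).sub
        (hA.hasFDerivAt_sub hs hst ht v)).hasFDerivWithinAt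
    · simpa using hA.norm_deriv_sub_le s t (v + (y' - y)) v hs hst ht
  have e1 : x' - (x + (y' - y)) = x' - y' - (x - y) := by abel
  rw [e1] at h1
  rw [add_sub_cancel] at h2
  have e2 : A t x' - A s x' - (A t y' - A s y') - (A t x - A s x - (A t y - A s y))
      = (A t x' - A s x' - (A t (x + (y' - y)) - A s (x + (y' - y))))
      + (A t (x + (y' - y)) - A s (x + (y' - y)) - (A t x - A s x)
        - (A t y' - A s y' - (A t y - A s y))) := by abel
  rw [e2]
  refine (norm_add_le _ _).trans ?_
  linarith

end IsYoungDriver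

namespace IsYoungDriver

variable {V : Type*} [NormedAddCommGroup V] [NormedSpace ℝ V]
  {A : ℝ → V → V} {DA : ℝ → V → (V →L[ℝ] V)} {M α β T : ℝ}

lemma nonneg (hA : IsYoungDriver A DA M α β T) (hT : 0 < T) : 0 ≤ M := by
  have h := (norm_nonneg _).trans (hA.norm_increment_le 0 T 0 le_rfl hT.le le_rfl)
  exact nonneg_of_mul_nonneg_left h (Real.rpow_pos_of_pos (by linarith) _)

lemma grid_mono {τ : ℕ → ℝ} {h : ℝ} (hh : 0 ≤ h) (hτ : ∀ i j, τ j - τ i = ((j : ℝ) - i) * h) :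
    Monotone τ := by
  intro i j hij
  have : 0 ≤ ((j : ℝ) - i) * h := mul_nonneg (by simpa using hij) hh
  linarith [hτ i j]

/-- Remainder estimate for an approximate discrete solution on a uniform grid. -/
lemma grid_remainder (hA : IsYoungDriver A DA M α β T) (hα : 1 < 2 * α) (hM : 0 ≤ M)
    {τ : ℕ → ℝ} {h : ℝ} (hh : 0 ≤ h) (hτ : ∀ i j, τ j - τ i = ((j : ℝ) - i) * h)
    {N : ℕ} (hN : 1 ≤ N) (h0 : 0 ≤ τ 0) (hNT : τ N ≤ T) {z : ℕ → V} {L b : ℝ} (hL : 0 ≤ L)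
    (hz : ∀ i j, i ≤ j → j ≤ N → ‖z j - z i‖ ≤ L * (((j : ℝ) - i) * h) ^ α)
    (hb : ∀ i < N, ‖z (i + 1) - z i - (A (τ (i + 1)) (z i) - A (τ i) (z i))‖ ≤ b) :
    ‖z N - z 0 - (A (τ N) (z 0) - A (τ 0) (z 0))‖
      ≤ N * b + sewingConst (2 * α) * M * L * (N * h) ^ (2 * α) := by
  have hmono := grid_mono hh hτ
  have key := discrete_sewing (θ := 2 * α) (a := M * L * h ^ (2 * α)) (b := b) hα
    (by positivity) hN
    (fun i j => z j - z i - (A (τ j) (z i) - A (τ i) (z i))) hb ?_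
  · refine key.trans_eq ?_
    rw [Real.mul_rpow (by positivity) hh]
    ring
  intro i k j hik hkj hj
  have hi0 : 0 ≤ τ i := h0.trans (hmono (Nat.zero_le _))
  have hjT : τ j ≤ T := (hmono hj).trans hNT
  have e : z j - z i - (A (τ j) (z i) - A (τ i) (z i))
      - (z k - z i - (A (τ k) (z i) - A (τ i) (z i)))
      - (z j - z k - (A (τ j) (z k) - A (τ k) (z k)))
      = A (τ j) (z k) - A (τ k) (z k) - (A (τ j) (z i) - A (τ k) (z i)) := by abel
  have hik' : (i : ℝ) ≤ k := by exact_mod_cast hik.le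
  have hkj' : (k : ℝ) ≤ j := by exact_mod_cast hkj.le
  have hα0 : 0 < α := by linarith
  have h1 := hA.lipschitz (hi0.trans (hmono hik.le)) (hmono hkj.le) hjT (z k) (z i)
  have h2 := hz i k hik.le (hkj.le.trans hj)
  rw [hτ] at h1
  have hji : 0 ≤ (j : ℝ) - i := by linarith
  simp only [e]
  calc _ ≤ _ := h1
    _ ≤ M * (((j : ℝ) - k) * h) ^ α * (L * (((k : ℝ) - i) * h) ^ α) := by
        gcongr
    _ ≤ M * (((j : ℝ) - i) * h) ^ α * (L * (((j : ℝ) - i) * h) ^ α) := by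
        have h3 : 0 ≤ ((j : ℝ) - k) * h := mul_nonneg (by linarith) hh
        have h4 : 0 ≤ ((k : ℝ) - i) * h := mul_nonneg (by linarith) hh
        gcongr
    _ = M * L * ((((j : ℝ) - i) * h) ^ α * (((j : ℝ) - i) * h) ^ α) := by ring
    _ = _ := by
        rw [← Real.rpow_add_of_nonneg (by positivity) hα0.le hα0.le, ← two_mul,
          Real.mul_rpow hji hh]
        ring

/-- Stability estimate for the difference of two approximate discrete solutions. -/
lemma grid_difference_remainder (hA : IsYoungDriver A DA M α β T) (hα : 0 < α) (hβ : 0 < β)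
    (hβ1 : β < 1) (hαβ : 1 < α * (1 + β)) (hM : 0 ≤ M)
    {τ : ℕ → ℝ} {h : ℝ} (hh : 0 ≤ h) (hτ : ∀ i j, τ j - τ i = ((j : ℝ) - i) * h)
    {N : ℕ} (hN : 1 ≤ N) (h0 : 0 ≤ τ 0) (hNT : τ N ≤ T) {x y : ℕ → V} {L Ly S b : ℝ}
    (hL : 0 ≤ L) (hLy : 0 ≤ Ly) (hS : 0 ≤ S)
    (hy : ∀ i j, i ≤ j → j ≤ N → ‖y j - y i‖ ≤ Ly * (((j : ℝ) - i) * h) ^ α)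
    (he : ∀ i j, i ≤ j → j ≤ N → ‖x j - y j - (x i - y i)‖ ≤ L * (((j : ℝ) - i) * h) ^ α)
    (heS : ∀ i ≤ N, ‖x i - y i‖ ≤ S)
    (hb : ∀ i < N, ‖x (i + 1) - y (i + 1) - (x i - y i)
      - (A (τ (i + 1)) (x i) - A (τ i) (x i) - (A (τ (i + 1)) (y i) - A (τ i) (y i)))‖ ≤ b) :
    ‖x N - y N - (x 0 - y 0)
        - (A (τ N) (x 0) - A (τ 0) (x 0) - (A (τ N) (y 0) - A (τ 0) (y 0)))‖
      ≤ N * b + sewingConst (α * (1 + β)) * M * (L * (N * h) ^ α + (Ly * (N * h) ^ α) ^ β * S)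
        * (N * h) ^ α := by
  have hmono := grid_mono hh hτ
  have key := discrete_sewing (θ := α * (1 + β))
    (a := M * (L * (N * h) ^ (α * (1 - β)) + Ly ^ β * S) * h ^ (α * (1 + β))) (b := b) hαβ
    (by positivity) hN
    (fun i j => x j - y j - (x i - y i)
      - (A (τ j) (x i) - A (τ i) (x i) - (A (τ j) (y i) - A (τ i) (y i)))) hb ?_
  · refine key.trans_eq ?_
    have hw : (0 : ℝ) ≤ N * h := by positivity
    have e1 : ((N : ℝ) * h) ^ (α * (1 + β)) = (N * h) ^ α * (N * h) ^ (α * β) := by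
      rw [← Real.rpow_add_of_nonneg hw hα.le (by positivity)]; congr 1; ring
    have e2 : ((N : ℝ) * h) ^ α = (N * h) ^ (α * (1 - β)) * (N * h) ^ (α * β) := by
      have : 0 ≤ 1 - β := by linarith
      rw [← Real.rpow_add_of_nonneg hw (by positivity) (by positivity)]; congr 1; ring
    have e3 : (Ly * ((N : ℝ) * h) ^ α) ^ β = Ly ^ β * (N * h) ^ (α * β) := by
      rw [Real.mul_rpow hLy (by positivity), ← Real.rpow_mul hw]
    have e4 : (h : ℝ) ^ (α * (1 + β)) * (N : ℝ) ^ (α * (1 + β)) = (N * h) ^ (α * (1 + β)) := by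
      rw [Real.mul_rpow (by positivity) hh]; ring
    rw [e3]
    calc (N : ℝ) * b + sewingConst (α * (1 + β))
          * (M * (L * (N * h) ^ (α * (1 - β)) + Ly ^ β * S) * h ^ (α * (1 + β)))
          * (N : ℝ) ^ (α * (1 + β))
        = N * b + sewingConst (α * (1 + β)) * M * (L * (N * h) ^ (α * (1 - β)) + Ly ^ β * S)
          * (h ^ (α * (1 + β)) * (N : ℝ) ^ (α * (1 + β))) := by ring
      _ = N * b + sewingConst (α * (1 + β)) * M
          * (L * ((N * h) ^ (α * (1 - β)) * (N * h) ^ (α * β)) + Ly ^ β * (N * h) ^ (α * β) * S)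
          * (N * h) ^ α := by rw [e4, e1]; ring
      _ = _ := by rw [← e2]
  intro i k j hik hkj hj
  have hi0 : 0 ≤ τ i := h0.trans (hmono (Nat.zero_le _))
  have hjT : τ j ≤ T := (hmono hj).trans hNT
  have e : x j - y j - (x i - y i)
      - (A (τ j) (x i) - A (τ i) (x i) - (A (τ j) (y i) - A (τ i) (y i)))
      - (x k - y k - (x i - y i)
      - (A (τ k) (x i) - A (τ i) (x i) - (A (τ k) (y i) - A (τ i) (y i))))
      - (x j - y j - (x k - y k)
      - (A (τ j) (x k) - A (τ k) (x k) - (A (τ j) (y k) - A (τ k) (y k))))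
      = A (τ j) (x k) - A (τ k) (x k) - (A (τ j) (y k) - A (τ k) (y k))
        - (A (τ j) (x i) - A (τ k) (x i) - (A (τ j) (y i) - A (τ k) (y i))) := by abel
  have hik' : (i : ℝ) ≤ k := by exact_mod_cast hik.le
  have hkj' : (k : ℝ) ≤ j := by exact_mod_cast hkj.le
  have hjN : (j : ℝ) ≤ N := by exact_mod_cast hj
  have h1 := hA.four_point (hi0.trans (hmono hik.le)) (hmono hkj.le) hjT (x i) (y i) (x k) (y k)
  have h2 := he i k hik.le (hkj.le.trans hj)
  have h2' := hy i k hik.le (hkj.le.trans hj)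
  have h2'' := heS i ((hik.le.trans hkj.le).trans hj)
  rw [hτ] at h1
  have hji : 0 ≤ (j : ℝ) - i := by linarith
  have h3 : 0 ≤ ((j : ℝ) - k) * h := mul_nonneg (by linarith) hh
  have h4 : 0 ≤ ((k : ℝ) - i) * h := mul_nonneg (by linarith) hh
  have hd : 0 ≤ ((j : ℝ) - i) * h := mul_nonneg hji hh
  have h1β : 0 ≤ 1 - β := by linarith
  simp only [e]
  calc _ ≤ _ := h1
    _ ≤ M * (((j : ℝ) - k) * h) ^ α * (L * (((k : ℝ) - i) * h) ^ α
        + (Ly * (((k : ℝ) - i) * h) ^ α) ^ β * S) := by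
        gcongr
    _ ≤ M * (((j : ℝ) - i) * h) ^ α * (L * (((j : ℝ) - i) * h) ^ α
        + (Ly * (((j : ℝ) - i) * h) ^ α) ^ β * S) := by
        gcongr
    _ = M * (((j : ℝ) - i) * h) ^ α * (L * ((((j : ℝ) - i) * h) ^ (α * (1 - β))
          * (((j : ℝ) - i) * h) ^ (α * β)) + Ly ^ β * (((j : ℝ) - i) * h) ^ (α * β) * S) := by
        rw [Real.mul_rpow hLy (by positivity), ← Real.rpow_mul hd,
          ← Real.rpow_add_of_nonneg hd (by positivity) (by positivity)]
        congr 5; ring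
    _ ≤ M * (((j : ℝ) - i) * h) ^ α * (L * ((N * h) ^ (α * (1 - β))
          * (((j : ℝ) - i) * h) ^ (α * β)) + Ly ^ β * (((j : ℝ) - i) * h) ^ (α * β) * S) := by
        gcongr
        linarith [(Nat.cast_nonneg i : (0 : ℝ) ≤ i)]
    _ = M * (L * (N * h) ^ (α * (1 - β)) + Ly ^ β * S)
          * ((((j : ℝ) - i) * h) ^ α * (((j : ℝ) - i) * h) ^ (α * β)) := by ring
    _ = _ := by
        rw [← Real.rpow_add_of_nonneg hd hα.le (by positivity)]
        rw [show α + α * β = α * (1 + β) by ring, Real.mul_rpow hji hh]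
        ring

end IsYoungDriver

namespace IsYoungDriver

variable {V : Type*} [NormedAddCommGroup V] [NormedSpace ℝ V]
  {A : ℝ → V → V} {DA : ℝ → V → (V →L[ℝ] V)} {M α β T : ℝ}

/-- A solution satisfies the remainder estimate with a constant that does not depend on the
one in its definition. -/
lemma solution_remainder (hA : IsYoungDriver A DA M α β T) (hα : 1 < 2 * α) (hM : 0 ≤ M)
    {θ K L : ℝ} (hθ : 1 < θ) (hL : 0 ≤ L) {x : ℝ → V}
    (hx : ∀ s t, 0 ≤ s → s ≤ t → t ≤ T →
      ‖x t - x s - (A t (x s) - A s (x s))‖ ≤ K * (t - s) ^ θ)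
    {s t : ℝ} (hs : 0 ≤ s) (hst : s ≤ t) (ht : t ≤ T)
    (hxL : ∀ u v, s ≤ u → u ≤ v → v ≤ t → ‖x v - x u‖ ≤ L * (v - u) ^ α) :
    ‖x t - x s - (A t (x s) - A s (x s))‖
      ≤ sewingConst (2 * α) * M * L * (t - s) ^ (2 * α) := by
  have hN : ∀ N : ℕ, 1 ≤ N → ‖x t - x s - (A t (x s) - A s (x s))‖ ≤
      K * (t - s) ^ θ * (N : ℝ) ^ (-(θ - 1)) + sewingConst (2 * α) * M * L * (t - s) ^ (2 * α) := by
    intro N hN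
    have hN0 : (0 : ℝ) < N := by exact_mod_cast hN
    have hh : 0 ≤ (t - s) / N := div_nonneg (sub_nonneg.2 hst) hN0.le
    have hNh : (N : ℝ) * ((t - s) / N) = t - s := by field_simp
    set τ : ℕ → ℝ := fun k => s + k * ((t - s) / N) with hτdef
    have hτ : ∀ i j, τ j - τ i = ((j : ℝ) - i) * ((t - s) / N) := fun i j => by
      simp only [hτdef]; ring
    have hmono := grid_mono hh hτ
    have hτ0 : τ 0 = s := by simp [hτdef]
    have hτN : τ N = t := by simp only [hτdef]; linarith
    have key := hA.grid_remainder hα hM hh hτ hN (hτ0 ▸ hs) (hτN ▸ ht) (z := fun k => x (τ k))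
      (b := K * ((t - s) / N) ^ θ) hL ?_ ?_
    · rw [hτN, hτ0, hNh] at key
      refine key.trans_eq ?_
      rw [Real.div_rpow (sub_nonneg.2 hst) hN0.le, Real.rpow_neg hN0.le,
        Real.rpow_sub_one hN0.ne']
      field_simp
    · intro i j hij hj
      rw [← hτ]
      exact hxL _ _ (hτ0 ▸ hmono (Nat.zero_le i)) (hmono hij) (hτN ▸ hmono hj)
    · intro i hi
      have := hx (τ i) (τ (i + 1)) (hs.trans (hτ0 ▸ hmono (Nat.zero_le i)))
        (hmono (Nat.le_succ i)) ((hτN ▸ hmono hi : τ (i + 1) ≤ t).trans ht)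
      rw [hτ i (i + 1)] at this
      simpa using this
  have hlim : Filter.Tendsto (fun N : ℕ => K * (t - s) ^ θ * (N : ℝ) ^ (-(θ - 1))
      + sewingConst (2 * α) * M * L * (t - s) ^ (2 * α)) Filter.atTop
      (nhds (K * (t - s) ^ θ * 0 + sewingConst (2 * α) * M * L * (t - s) ^ (2 * α))) :=
    (tendsto_const_nhds.mul ((tendsto_rpow_neg_atTop (by linarith)).comp
      tendsto_natCast_atTop_atTop)).add_const _
  rw [mul_zero, zero_add] at hlim
  exact ge_of_tendsto hlim (Filter.eventually_atTop.2 ⟨1, hN⟩)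

/-- On short time intervals the Hölder constant of a solution is controlled by the driver. -/
lemma solution_holder (hA : IsYoungDriver A DA M α β T) (hα : 1 < 2 * α) (hM : 0 ≤ M)
    {θ K Kx Δ : ℝ} (hθ : 1 < θ) {x : ℝ → V}
    (hxK : ∀ s t, 0 ≤ s → s ≤ t → t ≤ T → ‖x t - x s‖ ≤ Kx * (t - s) ^ α)
    (hx : ∀ s t, 0 ≤ s → s ≤ t → t ≤ T →
      ‖x t - x s - (A t (x s) - A s (x s))‖ ≤ K * (t - s) ^ θ)
    (hΔ : 2 * sewingConst (2 * α) * M * Δ ^ α ≤ 1)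
    {s t : ℝ} (hs : 0 ≤ s) (hst : s ≤ t) (ht : t ≤ T) (htΔ : t - s ≤ Δ) :
    ‖x t - x s‖ ≤ 2 * M * (t - s) ^ α := by
  have hc := sewingConst_pos hα
  refine le_two_mul_of_bootstrap (ι := ℝ × ℝ) (L₀ := |Kx|)
    (p := fun u => 0 ≤ u.1 ∧ u.1 ≤ u.2 ∧ u.2 ≤ T ∧ u.2 - u.1 ≤ Δ)
    (f := fun u => ‖x u.2 - x u.1‖) (g := fun u => (u.2 - u.1) ^ α) (abs_nonneg _) hM
    ?_ ?_ (s, t) ⟨hs, hst, ht, htΔ⟩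
  · rintro ⟨u, v⟩ ⟨hu, huv, hv, -⟩
    refine (hxK u v hu huv hv).trans ?_
    have : 0 ≤ v - u := sub_nonneg.2 huv
    dsimp only
    gcongr
    exact le_abs_self _
  · rintro L hL hind ⟨u, v⟩ ⟨hu, huv, hv, hΔ'⟩
    dsimp only at hu huv hv hΔ' ⊢
    have h0 : 0 ≤ v - u := sub_nonneg.2 huv
    have h1 := hA.solution_remainder hα hM hθ hL hx hu huv hv fun a b ha hab hb =>
      hind (a, b) ⟨hu.trans ha, hab, hb.trans hv, by dsimp only; linarith⟩
    have h2 := hA.norm_increment_le u v (x u) hu huv hv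
    have h3 := norm_le_norm_sub_add (x v - x u) (A v (x u) - A u (x u))
    have h4 : sewingConst (2 * α) * M * L * (v - u) ^ (2 * α)
        ≤ sewingConst (2 * α) * M * Δ ^ α * L * (v - u) ^ α := by
      rw [two_mul α, Real.rpow_add_of_nonneg h0 (by linarith) (by linarith)]
      calc _ = sewingConst (α + α) * M * (v - u) ^ α * L * (v - u) ^ α := by ring
        _ ≤ _ := by have : 0 < sewingConst (α + α) := by rwa [← two_mul]
                    gcongr
                    linarith
    have h5 : sewingConst (2 * α) * M * Δ ^ α * L * (v - u) ^ α ≤ 1 / 2 * L * (v - u) ^ α := by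
      gcongr
      linarith
    linarith

/-- Crude Hölder bound for a discrete Euler path. -/
lemma euler_holder_crude (hA : IsYoungDriver A DA M α β T) (hα : 0 < α) (hM : 0 ≤ M)
    {τ : ℕ → ℝ} {h : ℝ} (hh : 0 ≤ h) (hτ : ∀ i j, τ j - τ i = ((j : ℝ) - i) * h)
    {N : ℕ} (h0 : 0 ≤ τ 0) (hNT : τ N ≤ T) {y : ℕ → V}
    (hy : ∀ i < N, y (i + 1) = y i + (A (τ (i + 1)) (y i) - A (τ i) (y i)))
    {i j : ℕ} (hij : i ≤ j) (hj : j ≤ N) :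
    ‖y j - y i‖ ≤ N * M * (((j : ℝ) - i) * h) ^ α := by
  obtain ⟨m, rfl⟩ := Nat.exists_eq_add_of_le hij
  have hmono := grid_mono hh hτ
  have h1 := norm_sub_le_mul_of_step (y := y) (N := N) (B := M * h ^ α) (fun k hk => by
    have := hA.norm_increment_le (τ k) (τ (k + 1)) (y k) (h0.trans (hmono (Nat.zero_le _)))
      (hmono (Nat.le_succ k)) ((hmono hk).trans hNT)
    rw [hτ] at this
    rw [hy k hk, add_sub_cancel_left]
    simpa using this) i m hj
  push_cast
  rw [add_sub_cancel_left]
  rcases Nat.eq_zero_or_pos m with rfl | hm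
  · simp only [Nat.add_zero, sub_self, norm_zero]
    positivity
  have hm1 : (1 : ℝ) ≤ m := by exact_mod_cast hm
  have hmN : (m : ℝ) ≤ N := by exact_mod_cast (by omega : m ≤ N)
  calc _ ≤ _ := h1
    _ = m * M * (1 * h) ^ α := by ring_nf
    _ ≤ N * M * (m * h) ^ α := by gcongr

/-- On short time intervals the Hölder constant of a discrete Euler path is controlled by the
driver. -/
lemma euler_holder (hA : IsYoungDriver A DA M α β T) (hα : 1 < 2 * α) (hM : 0 ≤ M)
    {τ : ℕ → ℝ} {h : ℝ} (hh : 0 ≤ h) (hτ : ∀ i j, τ j - τ i = ((j : ℝ) - i) * h)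
    {N : ℕ} (h0 : 0 ≤ τ 0) (hNT : τ N ≤ T) {y : ℕ → V}
    (hy : ∀ i < N, y (i + 1) = y i + (A (τ (i + 1)) (y i) - A (τ i) (y i)))
    (hΔ : 2 * sewingConst (2 * α) * M * (N * h) ^ α ≤ 1)
    {i j : ℕ} (hij : i ≤ j) (hj : j ≤ N) :
    ‖y j - y i‖ ≤ 2 * M * (((j : ℝ) - i) * h) ^ α := by
  have hc := sewingConst_pos hα
  have hα0 : 0 < α := by linarith
  have hmono := grid_mono hh hτ
  refine le_two_mul_of_bootstrap (ι := ℕ × ℕ) (L₀ := N * M)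
    (p := fun u => u.1 ≤ u.2 ∧ u.2 ≤ N)
    (f := fun u => ‖y u.2 - y u.1‖) (g := fun u => (((u.2 : ℝ) - u.1) * h) ^ α)
    (by positivity) hM ?_ ?_ (i, j) ⟨hij, hj⟩
  · rintro ⟨i, j⟩ ⟨hij, hj⟩
    exact hA.euler_holder_crude hα0 hM hh hτ h0 hNT hy hij hj
  · rintro L hL hind ⟨i, j⟩ ⟨hij, hj⟩
    dsimp only at hij hj ⊢
    obtain ⟨m, rfl⟩ := Nat.exists_eq_add_of_le hij
    have hmN : (m : ℝ) ≤ N := by exact_mod_cast (by omega : m ≤ N)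
    have hi0 : 0 ≤ τ i := h0.trans (hmono (Nat.zero_le i))
    push_cast
    rw [add_sub_cancel_left]
    rcases Nat.eq_zero_or_pos m with rfl | hm
    · simp only [Nat.add_zero, sub_self, norm_zero]
      positivity
    have h1 := hA.grid_remainder hα hM hh (τ := fun k => τ (i + k)) (z := fun k => y (i + k))
      (fun a b => by rw [hτ]; push_cast; ring) hm hi0 ((hmono hj).trans hNT)
      (b := 0) hL (fun a b hab hb => by
        have := hind (i + a, i + b) ⟨by dsimp only; omega, by dsimp only; omega⟩
        dsimp only at this
        push_cast at this
        rwa [add_sub_add_left_eq_sub] at this)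
      (fun a ha => by
        have := hy (i + a) (by omega)
        rw [add_assoc] at this
        rw [this, add_sub_cancel_left, sub_self, norm_zero])
    rw [mul_zero, zero_add, Nat.add_zero] at h1
    have h2 := hA.norm_increment_le (τ i) (τ (i + m)) (y i) hi0 (hmono hij) ((hmono hj).trans hNT)
    have h3 := norm_le_norm_sub_add (y (i + m) - y i) (A (τ (i + m)) (y i) - A (τ i) (y i))
    rw [hτ] at h2
    push_cast at h2
    rw [add_sub_cancel_left] at h2
    have h4 : sewingConst (2 * α) * M * L * (m * h) ^ (2 * α)
        ≤ sewingConst (2 * α) * M * (N * h) ^ α * L * (m * h) ^ α := by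
      rw [two_mul α, Real.rpow_add_of_nonneg (by positivity) hα0.le hα0.le]
      calc _ = sewingConst (α + α) * M * (m * h) ^ α * L * (m * h) ^ α := by ring
        _ ≤ _ := by have : 0 < sewingConst (α + α) := by rwa [← two_mul]
                    gcongr
    have h5 : sewingConst (2 * α) * M * (N * h) ^ α * L * (m * h) ^ α
        ≤ 1 / 2 * L * (m * h) ^ α := by
      gcongr
      linarith
    linarith

/-- Error propagation on a short block of the grid. -/
lemma error_window (hA : IsYoungDriver A DA M α β T) (hα : 0 < α) (hβ : 0 < β)
    (hβ1 : β < 1) (hαβ : 1 < α * (1 + β)) (hM : 0 ≤ M)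
    {τ : ℕ → ℝ} {h : ℝ} (hh : 0 ≤ h) (hτ : ∀ i j, τ j - τ i = ((j : ℝ) - i) * h)
    {N : ℕ} (h0 : 0 ≤ τ 0) (hNT : τ N ≤ T) {x y : ℕ → V} {b ρ L₀ : ℝ} (hρ : 0 ≤ ρ)
    (hL₀ : 0 ≤ L₀)
    (hy : ∀ i j, i ≤ j → j ≤ N → ‖y j - y i‖ ≤ 2 * M * (((j : ℝ) - i) * h) ^ α)
    (he : ∀ i j, i ≤ j → j ≤ N → ‖x j - y j - (x i - y i)‖ ≤ L₀ * (((j : ℝ) - i) * h) ^ α)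
    (hb : ∀ i < N, ‖x (i + 1) - y (i + 1) - (x i - y i)
      - (A (τ (i + 1)) (x i) - A (τ i) (x i) - (A (τ (i + 1)) (y i) - A (τ i) (y i)))‖ ≤ b)
    (hbρ : ∀ m : ℕ, m ≤ N → m * b ≤ ρ * (m * h) ^ α)
    (hΔ₁ : 2 * M * (N * h) ^ α ≤ 1)
    (hΔ₂ : 2 * (2 * sewingConst (α * (1 + β)) + 1) * M * (N * h) ^ α ≤ 1)
    {i j : ℕ} (hij : i ≤ j) (hj : j ≤ N) :
    ‖x j - y j - (x i - y i)‖
      ≤ 2 * (ρ + (sewingConst (α * (1 + β)) + 1) * M * ‖x 0 - y 0‖)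
        * (((j : ℝ) - i) * h) ^ α := by
  have hc := sewingConst_pos hαβ
  have hmono := grid_mono hh hτ
  set c := sewingConst (α * (1 + β)) with hcdef
  refine le_two_mul_of_bootstrap (ι := ℕ × ℕ) (L₀ := L₀)
    (p := fun u => u.1 ≤ u.2 ∧ u.2 ≤ N)
    (f := fun u => ‖x u.2 - y u.2 - (x u.1 - y u.1)‖)
    (g := fun u => (((u.2 : ℝ) - u.1) * h) ^ α)
    hL₀ (by positivity) (fun u hu => he u.1 u.2 hu.1 hu.2) ?_ (i, j) ⟨hij, hj⟩
  rintro L hL hind ⟨i, j⟩ ⟨hij, hj⟩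
  dsimp only at hij hj ⊢
  obtain ⟨m, rfl⟩ := Nat.exists_eq_add_of_le hij
  have hmN : (m : ℝ) ≤ N := by exact_mod_cast (by omega : m ≤ N)
  have hi0 : 0 ≤ τ i := h0.trans (hmono (Nat.zero_le i))
  push_cast
  rw [add_sub_cancel_left]
  rcases Nat.eq_zero_or_pos m with rfl | hm
  · simp only [Nat.add_zero, sub_self, norm_zero]
    positivity
  set S := ‖x 0 - y 0‖ + L * (N * h) ^ α with hS
  have hS0 : 0 ≤ S := by positivity
  have heS : ∀ k ≤ N, ‖x k - y k‖ ≤ S := by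
    intro k hk
    have h1 := hind (0, k) ⟨Nat.zero_le _, hk⟩
    have h2 := norm_le_norm_sub_add (x k - y k) (x 0 - y 0)
    dsimp only at h1
    rw [Nat.cast_zero, sub_zero] at h1
    have h3 : L * ((k : ℝ) * h) ^ α ≤ L * (N * h) ^ α := by gcongr
    linarith
  have h1 := hA.grid_difference_remainder hα hβ hβ1 hαβ hM hh (τ := fun k => τ (i + k))
    (x := fun k => x (i + k)) (y := fun k => y (i + k)) (b := b) (Ly := 2 * M) (S := S)
    (fun a b => by rw [hτ]; push_cast; ring) hm hi0 ((hmono hj).trans hNT)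
    hL (by positivity) hS0
    (fun a b hab hb => by
      have := hy (i + a) (i + b) (by omega) (by omega)
      push_cast at this
      rwa [add_sub_add_left_eq_sub] at this)
    (fun a b hab hb => by
      have := hind (i + a, i + b) ⟨by dsimp only; omega, by dsimp only; omega⟩
      dsimp only at this
      push_cast at this
      rwa [add_sub_add_left_eq_sub] at this)
    (fun a ha => heS _ (by omega))
    (fun a ha => hb (i + a) (by omega))
  rw [Nat.add_zero, ← hcdef] at h1
  have h2 := hA.lipschitz hi0 (hmono hij) ((hmono hj).trans hNT) (x i) (y i)
  have h3 := norm_le_norm_sub_add (x (i + m) - y (i + m) - (x i - y i))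
    (A (τ (i + m)) (x i) - A (τ i) (x i) - (A (τ (i + m)) (y i) - A (τ i) (y i)))
  rw [hτ] at h2
  push_cast at h2
  rw [add_sub_cancel_left] at h2
  have h4 : M * (m * h) ^ α * ‖x i - y i‖ ≤ M * (m * h) ^ α * S := by
    gcongr
    exact heS i (by omega)
  have h5 : (2 * M * (m * h) ^ α) ^ β ≤ 1 := by
    refine Real.rpow_le_one (by positivity) (le_trans ?_ hΔ₁) hβ.le
    gcongr
  have h6 : c * M * (L * (m * h) ^ α + (2 * M * (m * h) ^ α) ^ β * S) * (m * h) ^ α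
      ≤ c * M * (L * (N * h) ^ α + 1 * S) * (m * h) ^ α := by
    gcongr
  have h7 := hbρ m (by omega)
  have h8 : (2 * c + 1) * M * (N * h) ^ α * L * (m * h) ^ α ≤ 1 / 2 * L * (m * h) ^ α := by
    gcongr
    linarith
  have h9 : c * M * (L * (N * h) ^ α + 1 * S) * (m * h) ^ α + M * (m * h) ^ α * S
      = (c + 1) * M * ‖x 0 - y 0‖ * (m * h) ^ α
        + (2 * c + 1) * M * (N * h) ^ α * L * (m * h) ^ α := by
    rw [hS]; ring
  linarith

end IsYoungDriver

/-- `y` follows the Euler scheme of mesh `h` on the first `n` cells of the grid. -/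
def IsEulerPath {V : Type*} [AddCommGroup V] (A : ℝ → V → V) (h : ℝ) (n : ℕ) (y : ℝ → V) : Prop :=
  ∀ k < n, ∀ t : ℝ, (k : ℝ) * h ≤ t → t ≤ ((k : ℝ) + 1) * h →
    y t = y (k * h) + (A t (y (k * h)) - A (k * h) (y (k * h)))

/-- Estimates for a solution on time intervals of length at most `Δ`. -/
structure SolutionBounds {V : Type*} [NormedAddCommGroup V] (A : ℝ → V → V) (M α T Δ : ℝ)
    (x : ℝ → V) : Prop where
  holder : ∀ s t, 0 ≤ s → s ≤ t → t ≤ T → t - s ≤ Δ → ‖x t - x s‖ ≤ 2 * M * (t - s) ^ α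
  remainder : ∀ s t, 0 ≤ s → s ≤ t → t ≤ T → t - s ≤ Δ →
    ‖x t - x s - (A t (x s) - A s (x s))‖
      ≤ 2 * sewingConst (2 * α) * M ^ 2 * (t - s) ^ (2 * α)

lemma IsEulerPath.succ {V : Type*} [AddCommGroup V] {A : ℝ → V → V} {h : ℝ} {n : ℕ} {y : ℝ → V}
    (hy : IsEulerPath A h n y) (hh : 0 ≤ h) {k : ℕ} (hk : k < n) :
    y ((k + 1 : ℕ) * h) = y (k * h) + (A ((k + 1 : ℕ) * h) (y (k * h)) - A (k * h) (y (k * h))) := by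
  push_cast
  exact hy k hk _ (by linarith) le_rfl

namespace IsYoungDriver

variable {V : Type*} [NormedAddCommGroup V] [NormedSpace ℝ V]
  {A : ℝ → V → V} {DA : ℝ → V → (V →L[ℝ] V)} {M α β T : ℝ}

lemma solutionBounds (hA : IsYoungDriver A DA M α β T) (hα : 1 < 2 * α) (hM : 0 ≤ M)
    {θ K Kx Δ : ℝ} (hθ : 1 < θ) {x : ℝ → V}
    (hxK : ∀ s t, 0 ≤ s → s ≤ t → t ≤ T → ‖x t - x s‖ ≤ Kx * (t - s) ^ α)
    (hx : ∀ s t, 0 ≤ s → s ≤ t → t ≤ T →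
      ‖x t - x s - (A t (x s) - A s (x s))‖ ≤ K * (t - s) ^ θ)
    (hΔ : 2 * sewingConst (2 * α) * M * Δ ^ α ≤ 1) : SolutionBounds A M α T Δ x where
  holder s t hs hst ht htΔ := hA.solution_holder hα hM hθ hxK hx hΔ hs hst ht htΔ
  remainder s t hs hst ht htΔ := by
    refine (hA.solution_remainder hα hM hθ (L := 2 * M) (by positivity) hx hs hst ht
      fun u v hu huv hv => ?_).trans_eq (by ring)
    exact hA.solution_holder hα hM hθ hxK hx hΔ (hs.trans hu) huv (hv.trans ht) (by linarith)

/-- Hölder estimate for the error between grid points at distance at most `Δ`. -/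
lemma error_grid_window (hA : IsYoungDriver A DA M α β T) (hα : 1 < 2 * α) (hα1 : α < 1)
    (hβ : 0 < β) (hβ1 : β < 1) (hαβ : 1 < α * (1 + β)) (hM : 0 ≤ M) {h Δ : ℝ} (hh : 0 < h)
    {n : ℕ} (hnT : n * h = T) {x y : ℝ → V}
    (hx : SolutionBounds A M α T Δ x) (hy : IsEulerPath A h n y)
    (hΔ : (2 * sewingConst (2 * α) + 4 * sewingConst (α * (1 + β)) + 2) * M * Δ ^ α ≤ 1)
    (a k : ℕ) (hak : a + k ≤ n) (hk : k * h ≤ Δ) :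
    ‖x ((a + k : ℕ) * h) - y ((a + k : ℕ) * h) - (x (a * h) - y (a * h))‖
      ≤ 2 * (2 * sewingConst (2 * α) * M ^ 2 * T ^ (1 - α) * h ^ (2 * α - 1)
        + (sewingConst (α * (1 + β)) + 1) * M * ‖x (a * h) - y (a * h)‖) * (k * h) ^ α := by
  have hc₁ := sewingConst_pos hα
  have hc₂ := sewingConst_pos hαβ
  have hα0 : 0 < α := by linarith
  have hT : 0 ≤ T := by rw [← hnT]; positivity
  have hw : M * (k * h) ^ α ≤ M * Δ ^ α := by gcongr
  have hw0 : 0 ≤ M * (k * h) ^ α := by positivity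
  have hΔ' : (2 * sewingConst (2 * α) + 4 * sewingConst (α * (1 + β)) + 2) * (M * (k * h) ^ α) ≤ 1 :=
    (mul_le_mul_of_nonneg_left hw (by positivity)).trans (by linarith)
  have hτ : ∀ i j : ℕ, ((a + j : ℕ) : ℝ) * h - ((a + i : ℕ) : ℝ) * h = ((j : ℝ) - i) * h := by
    intro i j; push_cast; ring
  have hle : ∀ j : ℕ, j ≤ k → ((a + j : ℕ) : ℝ) * h ≤ T := fun j hj => by
    rw [← hnT]
    have : ((a + j : ℕ) : ℝ) ≤ n := by exact_mod_cast (by omega : a + j ≤ n)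
    gcongr
  have hmono := grid_mono hh.le hτ
  have hyE : ∀ i < k, y ((a + (i + 1) : ℕ) * h) = y ((a + i : ℕ) * h)
      + (A ((a + (i + 1) : ℕ) * h) (y ((a + i : ℕ) * h))
        - A ((a + i : ℕ) * h) (y ((a + i : ℕ) * h))) :=
    fun i hi => hy.succ hh.le (k := a + i) (by omega)
  have hdist : ∀ i j : ℕ, i ≤ j → j ≤ k → ((j : ℝ) - i) * h ≤ Δ := fun i j hij hj => by
    refine le_trans ?_ hk
    have : (j : ℝ) ≤ k := by exact_mod_cast hj
    have : (0 : ℝ) ≤ i := by positivity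
    gcongr
    linarith
  have hxH : ∀ i j : ℕ, i ≤ j → j ≤ k → ‖x ((a + j : ℕ) * h) - x ((a + i : ℕ) * h)‖
      ≤ 2 * M * (((j : ℝ) - i) * h) ^ α := fun i j hij hj => by
    have := hx.holder ((a + i : ℕ) * h) ((a + j : ℕ) * h) (by positivity) (hmono hij) (hle j hj)
      (by rw [hτ]; exact hdist i j hij hj)
    rwa [hτ] at this
  have hyH : ∀ i j : ℕ, i ≤ j → j ≤ k → ‖y ((a + j : ℕ) * h) - y ((a + i : ℕ) * h)‖
      ≤ 2 * M * (((j : ℝ) - i) * h) ^ α := fun i j hij hj =>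
    hA.euler_holder hα hM hh.le hτ (N := k) (y := fun j => y ((a + j : ℕ) * h)) (by positivity)
      (hle k le_rfl) hyE (by nlinarith) hij hj
  have key := hA.error_window hα0 hβ hβ1 hαβ hM hh.le hτ (N := k)
    (x := fun j => x ((a + j : ℕ) * h)) (y := fun j => y ((a + j : ℕ) * h))
    (b := 2 * sewingConst (2 * α) * M ^ 2 * h ^ (2 * α))
    (ρ := 2 * sewingConst (2 * α) * M ^ 2 * T ^ (1 - α) * h ^ (2 * α - 1))
    (L₀ := 4 * M) (by positivity) (hle k le_rfl) (by positivity) (by positivity) hyH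
    (fun i j hij hj => ?_) (fun i hi => ?_) (fun m hm => ?_) (by nlinarith) (by nlinarith)
    (Nat.zero_le k) le_rfl
  · simpa using key
  · have h1 := hxH i j hij hj
    have h2 := hyH i j hij hj
    have e : x ((a + j : ℕ) * h) - y ((a + j : ℕ) * h) - (x ((a + i : ℕ) * h) - y ((a + i : ℕ) * h))
      = x ((a + j : ℕ) * h) - x ((a + i : ℕ) * h)
        - (y ((a + j : ℕ) * h) - y ((a + i : ℕ) * h)) := by abel
    rw [e]
    refine (norm_sub_le _ _).trans ?_
    linarith
  · have h1 := hx.remainder ((a + i : ℕ) * h) ((a + (i + 1) : ℕ) * h) (by positivity)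
      (hmono (Nat.le_succ i)) (hle _ hi) (by rw [hτ]; exact hdist _ _ (Nat.le_succ i) hi)
    rw [hτ] at h1
    push_cast at h1
    rw [add_sub_cancel_left, one_mul] at h1
    have h2 := hyE i hi
    rw [h2]
    push_cast
    convert h1 using 2
    abel
  · have hm' : (m : ℝ) * h ≤ T := by
      rw [← hnT]
      have : (m : ℝ) ≤ n := by exact_mod_cast (by omega : m ≤ n)
      gcongr
    have hmh : (0 : ℝ) ≤ m * h := by positivity
    have e1 : h ^ (2 * α) = h * h ^ (2 * α - 1) := by
      rw [← Real.rpow_one_add' hh.le (by linarith)]; congr 1; ring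
    have e2 : (m : ℝ) * h = (m * h) ^ (1 - α) * (m * h) ^ α := by
      rw [← Real.rpow_add_of_nonneg hmh (by linarith) hα0.le]; simp
    calc (m : ℝ) * (2 * sewingConst (2 * α) * M ^ 2 * h ^ (2 * α))
        = 2 * sewingConst (2 * α) * M ^ 2 * (m * h) * h ^ (2 * α - 1) := by rw [e1]; ring
      _ = 2 * sewingConst (2 * α) * M ^ 2 * ((m * h) ^ (1 - α) * (m * h) ^ α)
          * h ^ (2 * α - 1) := by rw [← e2]
      _ ≤ 2 * sewingConst (2 * α) * M ^ 2 * (T ^ (1 - α) * (m * h) ^ α)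
          * h ^ (2 * α - 1) := by
            have : 0 ≤ 1 - α := by linarith
            gcongr
      _ = _ := by ring

/-- Uniform estimate for the error at the grid points. -/
lemma error_grid_sup (hA : IsYoungDriver A DA M α β T) (hα : 1 < 2 * α) (hα1 : α < 1)
    (hβ : 0 < β) (hβ1 : β < 1) (hαβ : 1 < α * (1 + β)) (hM : 0 ≤ M) {h Δ : ℝ} (hh : 0 < h)
    {n : ℕ} (hnT : n * h = T) (hΔT : Δ ≤ T) (hhΔ : h ≤ Δ) {x y : ℝ → V}
    (hx : SolutionBounds A M α T Δ x) (hy : IsEulerPath A h n y) (hxy : x 0 = y 0)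
    (hΔ : (2 * sewingConst (2 * α) + 4 * sewingConst (α * (1 + β)) + 2) * M * Δ ^ α ≤ 1)
    (i : ℕ) (hi : i ≤ n) :
    ‖x (i * h) - y (i * h)‖ ≤ Real.exp (2 * (2 * (T / Δ) + 1))
      * (4 * sewingConst (2 * α) * M ^ 2 * T ^ (1 - α) * h ^ (2 * α - 1) * T ^ α) := by
  have hc₁ := sewingConst_pos hα
  have hc₂ := sewingConst_pos hαβ
  have hα0 : 0 < α := by linarith
  have hΔ0 : 0 < Δ := hh.trans_le hhΔ
  have hT : 0 < T := hΔ0.trans_le hΔT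
  set ρ := 2 * sewingConst (2 * α) * M ^ 2 * T ^ (1 - α) * h ^ (2 * α - 1) with hρ
  have hρ0 : 0 ≤ ρ := by positivity
  obtain ⟨m, hm, hmΔ, hmΔ'⟩ : ∃ m : ℕ, 1 ≤ m ∧ m * h ≤ Δ ∧ Δ ≤ 2 * (m * h) := by
    have h1 : 1 ≤ ⌊Δ / h⌋₊ := Nat.le_floor (by simpa using (one_le_div hh).2 hhΔ)
    refine ⟨⌊Δ / h⌋₊, h1, (le_div_iff₀ hh).1 (Nat.floor_le (by positivity)), ?_⟩
    have h2 := (div_le_iff₀ hh).1 (Nat.lt_floor_add_one (Δ / h)).le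
    have h3 : (1 : ℝ) ≤ (⌊Δ / h⌋₊ : ℝ) := by exact_mod_cast h1
    nlinarith
  have hgrow : ∀ a k, k ≤ m → a + k ≤ n →
      ‖x ((a + k : ℕ) * h) - y ((a + k : ℕ) * h)‖
        ≤ 2 * ‖x ((a : ℕ) * h) - y (a * h)‖ + 2 * ρ * T ^ α := by
    intro a k hk hak
    have hkΔ : (k : ℝ) * h ≤ Δ := le_trans (by gcongr) hmΔ
    have h1 := hA.error_grid_window hα hα1 hβ hβ1 hαβ hM hh hnT hx hy hΔ a k hak hkΔ
    rw [← hρ] at h1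
    have h2 := norm_le_norm_sub_add (x ((a + k : ℕ) * h) - y ((a + k : ℕ) * h))
      (x ((a : ℕ) * h) - y (a * h))
    have h3 : 2 * (ρ + (sewingConst (α * (1 + β)) + 1) * M * ‖x ((a : ℕ) * h) - y (a * h)‖)
        * (k * h) ^ α ≤ 2 * (ρ + (sewingConst (α * (1 + β)) + 1) * M
          * ‖x ((a : ℕ) * h) - y (a * h)‖) * Δ ^ α := by gcongr
    have h4 : 2 * (sewingConst (α * (1 + β)) + 1) * M * Δ ^ α ≤ 1 := by
      refine le_trans ?_ hΔ
      gcongr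
      linarith
    have h5 := mul_le_mul_of_nonneg_right h4 (norm_nonneg (x ((a : ℕ) * h) - y (a * h)))
    have h6 : 2 * ρ * Δ ^ α ≤ 2 * ρ * T ^ α := by gcongr
    linarith
  have h1 := norm_le_of_block_growth (E := fun i : ℕ => x (i * h) - y (i * h)) (by positivity)
    (by simp [hxy]) hgrow (n / m + 1) i hi
    (hi.trans (by rw [mul_comm]; exact (Nat.lt_mul_div_succ n hm).le))
  have h2 : ((n / m + 1 : ℕ) : ℝ) ≤ 2 * (T / Δ) + 1 := by
    have hm0 : (0 : ℝ) < m := by exact_mod_cast hm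
    have e : (n : ℝ) / m ≤ 2 * (T / Δ) := by
      rw [← hnT, div_le_iff₀ hm0]
      have e' : 2 * (n * h / Δ) * m = n * (2 * (m * h)) / Δ := by ring
      rw [e', le_div_iff₀ hΔ0]
      gcongr
    push_cast
    linarith [(Nat.cast_div_le : ((n / m : ℕ) : ℝ) ≤ (n : ℝ) / m)]
  have h3 : (3 : ℝ) ^ (n / m + 1) ≤ Real.exp (2 * (2 * (T / Δ) + 1)) := by
    calc (3 : ℝ) ^ (n / m + 1) ≤ (Real.exp 2) ^ (n / m + 1) := by
          gcongr
          linarith [Real.add_one_le_exp (2 : ℝ)]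
      _ = Real.exp (((n / m + 1 : ℕ) : ℝ) * 2) := by rw [Real.exp_nat_mul]
      _ ≤ _ := by
          apply Real.exp_le_exp.2
          linarith
  calc _ ≤ _ := h1
    _ ≤ Real.exp (2 * (2 * (T / Δ) + 1)) * (2 * ρ * T ^ α) := by gcongr
    _ = _ := by rw [hρ]; ring

/-- Hölder estimate for the error inside a cell of the grid. -/
lemma error_cell (hA : IsYoungDriver A DA M α β T) (hα : 1 < 2 * α) (hM : 0 ≤ M) {h Δ S : ℝ}
    (hh : 0 < h) {n : ℕ} (hnT : n * h = T) (hhΔ : h ≤ Δ) {x y : ℝ → V}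
    (hx : SolutionBounds A M α T Δ x) (hy : IsEulerPath A h n y)
    (hS : ∀ i : ℕ, i ≤ n → ‖x (i * h) - y (i * h)‖ ≤ S) (k : ℕ) (hk : k < n) (s t : ℝ)
    (hs : (k : ℝ) * h ≤ s) (hst : s ≤ t) (ht : t ≤ ((k : ℝ) + 1) * h) :
    ‖x t - y t - (x s - y s)‖
      ≤ (2 * sewingConst (2 * α) * M ^ 2 * h ^ α + M * (2 * M * h ^ α + S)) * (t - s) ^ α := by
  have hc₁ := sewingConst_pos hα
  have hα0 : 0 < α := by linarith
  have hk0 : 0 ≤ (k : ℝ) * h := by positivity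
  have hs0 : 0 ≤ s := hk0.trans hs
  have htT : t ≤ T := by
    refine ht.trans ?_
    rw [← hnT]
    have : (k : ℝ) + 1 ≤ n := by exact_mod_cast hk
    gcongr
  have hts : 0 ≤ t - s := sub_nonneg.2 hst
  have h1 := hx.remainder s t hs0 hst htT (by linarith)
  have h2 := hx.holder (k * h) s hk0 hs (hst.trans htT) (by linarith)
  have h3 := hA.lipschitz hs0 hst htT (x s) (y (k * h))
  have h4 := norm_sub_le_norm_sub_add_norm_sub (x s) (x (k * h)) (y (k * h))
  have h5 : 2 * M * (s - k * h) ^ α ≤ 2 * M * h ^ α := by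
    have : 0 ≤ s - k * h := sub_nonneg.2 hs
    gcongr
    linarith
  have h6 : (t - s) ^ (2 * α) ≤ h ^ α * (t - s) ^ α := by
    rw [two_mul, Real.rpow_add_of_nonneg hts hα0.le hα0.le]
    gcongr
    linarith
  have e : x t - y t - (x s - y s) = (x t - x s - (A t (x s) - A s (x s)))
      + (A t (x s) - A s (x s) - (A t (y (k * h)) - A s (y (k * h)))) := by
    rw [hy k hk t (hs.trans hst) ht, hy k hk s hs (hst.trans ht)]
    abel
  rw [e]
  calc _ ≤ _ := norm_add_le _ _
    _ ≤ 2 * sewingConst (2 * α) * M ^ 2 * (h ^ α * (t - s) ^ α)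
        + M * (t - s) ^ α * (2 * M * h ^ α + S) := by
      refine add_le_add (h1.trans (by gcongr)) (h3.trans ?_)
      gcongr
      linarith [hS k hk.le]
    _ = _ := by ring

/-- Hölder estimate for the error on intervals of length at most `Δ`, for a fine mesh. -/
lemma error_local (hA : IsYoungDriver A DA M α β T) (hα : 1 < 2 * α) (hα1 : α < 1)
    (hβ : 0 < β) (hβ1 : β < 1) (hαβ : 1 < α * (1 + β)) (hM : 0 ≤ M) {h Δ : ℝ} (hh : 0 < h)
    {n : ℕ} (hnT : n * h = T) (hΔT : Δ ≤ T) (hhΔ : h ≤ Δ) {x y : ℝ → V}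
    (hx : SolutionBounds A M α T Δ x) (hy : IsEulerPath A h n y) (hxy : x 0 = y 0)
    (hΔ : (2 * sewingConst (2 * α) + 4 * sewingConst (α * (1 + β)) + 2) * M * Δ ^ α ≤ 1) {S : ℝ}
    (hS : S = Real.exp (2 * (2 * (T / Δ) + 1))
      * (4 * sewingConst (2 * α) * M ^ 2 * T ^ (1 - α) * h ^ (2 * α - 1) * T ^ α))
    {s t : ℝ} (hs : 0 ≤ s) (hst : s ≤ t) (ht : t ≤ T) (htΔ : t - s ≤ Δ) :
    ‖x t - y t - (x s - y s)‖
      ≤ (2 * (2 * sewingConst (2 * α) * M ^ 2 * h ^ α + M * (2 * M * h ^ α + S))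
        + 2 * (2 * sewingConst (2 * α) * M ^ 2 * T ^ (1 - α) * h ^ (2 * α - 1)
          + (sewingConst (α * (1 + β)) + 1) * M * S)) * (t - s) ^ α := by
  have hc₁ := sewingConst_pos hα
  have hc₂ := sewingConst_pos hαβ
  have hT : 0 ≤ T := by rw [← hnT]; positivity
  have hS0 : 0 ≤ S := by rw [hS]; positivity
  have hsup : ∀ i : ℕ, i ≤ n → ‖x (i * h) - y (i * h)‖ ≤ S := fun i hi => by
    rw [hS]
    exact hA.error_grid_sup hα hα1 hβ hβ1 hαβ hM hh hnT hΔT hhΔ hx hy hxy hΔ i hi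
  refine holder_of_cell_of_grid (f := fun t => x t - y t) (by linarith) (by positivity)
    (by positivity) hh hnT (hA.error_cell hα hM hh hnT hhΔ hx hy hsup) ?_ hs hst ht htΔ
  intro i j hij hj hd
  obtain ⟨m, rfl⟩ := Nat.exists_eq_add_of_le hij
  have e : ((i + m : ℕ) : ℝ) - i = m := by push_cast; ring
  rw [e] at hd ⊢
  refine (hA.error_grid_window hα hα1 hβ hβ1 hαβ hM hh hnT hx hy hΔ i m hj hd).trans ?_
  gcongr
  exact hsup i (by omega)

/-- Crude Hölder bound for an Euler path. -/
lemma eulerPath_holder (hA : IsYoungDriver A DA M α β T) (hα : 0 < α) (hM : 0 ≤ M) {h : ℝ}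
    (hh : 0 < h) {n : ℕ} (hnT : n * h = T) {y : ℝ → V} (hy : IsEulerPath A h n y)
    {s t : ℝ} (hs : 0 ≤ s) (hst : s ≤ t) (ht : t ≤ T) :
    ‖y t - y s‖ ≤ (2 * M + n * M) * (t - s) ^ α := by
  refine holder_of_cell_of_grid hα hM (by positivity) hh hnT ?_ (Δ := T) ?_ hs hst ht (by linarith)
  · intro k hk s t hs hst ht
    have : (k : ℝ) + 1 ≤ n := by exact_mod_cast hk
    rw [hy k hk t (hs.trans hst) ht, hy k hk s hs (hst.trans ht)]
    have e : ∀ a b c d : V, a + (b - c) - (a + (d - c)) = b - d := fun a b c d => by abel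
    rw [e]
    refine hA.norm_increment_le s t _ (le_trans (by positivity) hs) hst (ht.trans ?_)
    rw [← hnT]
    gcongr
  · intro i j hij hj _
    exact hA.euler_holder_crude hα hM hh.le (τ := fun k => k * h) (N := n)
      (y := fun k => y (k * h)) (fun i j => by ring) (by simp) hnT.le
      (fun i hi => hy.succ hh.le hi) hij hj

end IsYoungDriver

/-- Polynomial and Gaussian factors are absorbed into `C * exp (C * M ^ 6)`. -/
lemma exists_mul_exp_pow_six_bound (D B : ℝ) (hD : 0 ≤ D) (hB : 0 ≤ B) :
    ∃ C : ℝ, 0 ≤ C ∧ ∀ M : ℝ, 0 ≤ M →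
      D * (1 + M) ^ 5 * Real.exp (B * (1 + M) ^ 2) ≤ C * Real.exp (C * M ^ 6) := by
  have hC : 0 ≤ D * Real.exp (4 * (B + 5)) := by positivity
  refine ⟨D * Real.exp (4 * (B + 5)) + 2 * (B + 5), by positivity, fun M hM => ?_⟩
  have h6 : M ^ 2 ≤ 1 + M ^ 6 := by
    rcases le_total M 1 with h | h
    · have h1 : M ^ 2 ≤ 1 := pow_le_one₀ hM h
      have h2 : 0 ≤ M ^ 6 := by positivity
      linarith
    · linarith [pow_le_pow_right₀ h (show 2 ≤ 6 by norm_num)]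
  have h1 : (1 + M) ^ 2 ≤ 4 + 2 * M ^ 6 := by nlinarith [sq_nonneg (1 - M)]
  have h2 : (1 + M) ^ 5 ≤ Real.exp (5 * (1 + M) ^ 2) := by
    calc (1 + M) ^ 5 ≤ (Real.exp M) ^ 5 := by
          gcongr
          linarith [Real.add_one_le_exp M]
      _ = Real.exp (5 * M) := by rw [← Real.exp_nat_mul]; norm_num
      _ ≤ _ := by
          apply Real.exp_le_exp.2
          nlinarith
  calc D * (1 + M) ^ 5 * Real.exp (B * (1 + M) ^ 2)
      ≤ D * Real.exp (5 * (1 + M) ^ 2) * Real.exp (B * (1 + M) ^ 2) := by gcongr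
    _ = D * Real.exp ((B + 5) * (1 + M) ^ 2) := by
        rw [mul_assoc, ← Real.exp_add]; congr 2; ring
    _ ≤ D * Real.exp ((B + 5) * (4 + 2 * M ^ 6)) := by gcongr
    _ = D * Real.exp (4 * (B + 5)) * Real.exp (2 * (B + 5) * M ^ 6) := by
        rw [mul_assoc, ← Real.exp_add]; congr 2; ring
    _ ≤ _ := by
        gcongr
        · linarith
        · linarith

namespace IsYoungDriver

variable {V : Type*} [NormedAddCommGroup V] [NormedSpace ℝ V]
  {A : ℝ → V → V} {DA : ℝ → V → (V →L[ℝ] V)} {M α β T : ℝ}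

lemma mul_div_rpow_le_one {κ Q : ℝ} (hα : 1 < 2 * α) (hT : 0 < T) (hM : 0 ≤ M) (hκ : 0 ≤ κ)
    (hQ : Q = ((1 + κ * T ^ α) * (1 + M)) ^ 2) : κ * M * (T / Q) ^ α ≤ 1 := by
  set u := (1 + κ * T ^ α) * (1 + M) with hu
  have hp : 0 ≤ κ * T ^ α := by positivity
  have hu1 : 1 ≤ u := by nlinarith [mul_nonneg hp hM]
  have hu0 : 0 < u := by linarith
  have h1 : u ≤ Q ^ α := by
    rw [hQ, ← Real.rpow_natCast u 2, ← Real.rpow_mul hu0.le]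
    exact Real.self_le_rpow_of_one_le hu1 (by push_cast; linarith)
  have hQ0 : 0 ≤ Q := by rw [hQ]; positivity
  rw [Real.div_rpow hT.le hQ0, ← mul_div_assoc, div_le_one (by linarith)]
  refine le_trans ?_ h1
  nlinarith

/-- Hölder bound for the error of the Euler scheme, for a fine mesh. -/
lemma error_holder_fine (hA : IsYoungDriver A DA M α β T) (hα : 1 < 2 * α) (hα1 : α < 1)
    (hβ : 0 < β) (hβ1 : β < 1) (hαβ : 1 < α * (1 + β)) (hT : 0 < T) (hM : 0 ≤ M) {h Q : ℝ}
    (hh : 0 < h) {n : ℕ} (hnT : n * h = T) (hQ : 1 ≤ Q) (hhQ : h ≤ T / Q) {x y : ℝ → V}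
    (hx : SolutionBounds A M α T (T / Q) x) (hy : IsEulerPath A h n y) (hxy : x 0 = y 0)
    (hΔ : (2 * sewingConst (2 * α) + 4 * sewingConst (α * (1 + β)) + 2) * M * (T / Q) ^ α ≤ 1)
    {s t : ℝ} (hs : 0 ≤ s) (hst : s ≤ t) (ht : t ≤ T) :
    ‖x t - y t - (x s - y s)‖ ≤ 2 * Q * (((8 * sewingConst (2 * α) + 4) * T ^ (1 - α)
      + (2 * sewingConst (α * (1 + β)) + 4) * (4 * sewingConst (2 * α)) * T ^ (1 - α) * T ^ α)
      * (1 + M) ^ 3 * Real.exp (4 * Q + 2) * h ^ (2 * α - 1)) * (t - s) ^ α := by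
  have hc₁ := sewingConst_pos hα
  have hc₂ := sewingConst_pos hαβ
  set c₁ := sewingConst (2 * α)
  set c₂ := sewingConst (α * (1 + β))
  have hQ0 : 0 < Q := by linarith
  have hhT : h ≤ T := hhQ.trans (div_le_self hT.le hQ)
  set X := Real.exp (4 * Q + 2) with hX
  have hX1 : 1 ≤ X := Real.one_le_exp (by linarith)
  set P := T ^ (1 - α) with hP
  have hP0 : 0 ≤ P := by positivity
  set g := h ^ (2 * α - 1) with hg
  have hg0 : 0 ≤ g := by positivity
  have hhα : h ^ α ≤ P * g := by
    have e : h ^ α = h ^ (1 - α) * g := by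
      rw [hg, ← Real.rpow_add hh]; congr 1; ring
    rw [e, hP]
    have : 0 ≤ 1 - α := by linarith
    gcongr
  have hTQ : 2 * (2 * (T / (T / Q)) + 1) = 4 * Q + 2 := by
    rw [div_div_cancel₀ hT.ne']; ring
  have hloc := fun {s t : ℝ} => hA.error_local hα hα1 hβ hβ1 hαβ hM hh hnT
    (div_le_self hT.le hQ) hhQ hx hy hxy hΔ rfl (s := s) (t := t)
  rw [hTQ] at hloc
  have hN : 1 ≤ ⌈Q⌉₊ := Nat.one_le_ceil_iff.2 hQ0
  have hN1 : Q ≤ ⌈Q⌉₊ := Nat.le_ceil Q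
  have hN2 : (⌈Q⌉₊ : ℝ) ≤ 2 * Q := by linarith [Nat.ceil_lt_add_one hQ0.le]
  have h1 : 2 * (2 * c₁ * M ^ 2 * h ^ α
        + M * (2 * M * h ^ α + X * (4 * c₁ * M ^ 2 * P * g * T ^ α)))
      + 2 * (2 * c₁ * M ^ 2 * P * g + (c₂ + 1) * M * (X * (4 * c₁ * M ^ 2 * P * g * T ^ α)))
      ≤ ((8 * c₁ + 4) * P + (2 * c₂ + 4) * (4 * c₁) * P * T ^ α) * (1 + M) ^ 3 * X * g := by
    have hW : 1 ≤ 1 + M := by linarith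
    have hM2 : M ^ 2 ≤ (1 + M) ^ 3 * X := by
      calc M ^ 2 ≤ (1 + M) ^ 2 := by gcongr; linarith
        _ ≤ (1 + M) ^ 3 := pow_le_pow_right₀ hW (by norm_num)
        _ ≤ (1 + M) ^ 3 * X := le_mul_of_one_le_right (by positivity) hX1
    have hM3 : M ^ 3 ≤ (1 + M) ^ 3 := by gcongr; linarith
    calc _ ≤ 2 * (2 * c₁ * M ^ 2 * (P * g)
          + M * (2 * M * (P * g) + X * (4 * c₁ * M ^ 2 * P * g * T ^ α)))
        + 2 * (2 * c₁ * M ^ 2 * P * g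
          + (c₂ + 1) * M * (X * (4 * c₁ * M ^ 2 * P * g * T ^ α))) := by gcongr
      _ = (8 * c₁ + 4) * P * g * M ^ 2
          + (2 * c₂ + 4) * (4 * c₁) * P * T ^ α * X * g * M ^ 3 := by ring
      _ ≤ (8 * c₁ + 4) * P * g * ((1 + M) ^ 3 * X)
          + (2 * c₂ + 4) * (4 * c₁) * P * T ^ α * X * g * (1 + M) ^ 3 := by gcongr
      _ = _ := by ring
  refine (holder_of_local (f := fun t => x t - y t) (by linarith) (by positivity) hN
    (fun s t hs hst ht hd => hloc hs hst ht (hd.trans (by gcongr))) hs hst ht).trans ?_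
  have hts : 0 ≤ t - s := sub_nonneg.2 hst
  gcongr

/-- Hölder bound for the error of the Euler scheme, for a coarse mesh. -/
lemma error_holder_coarse (hA : IsYoungDriver A DA M α β T) (hα : 0 < α) (hT : 0 < T) (hM : 0 ≤ M)
    {h Q : ℝ} (hh : 0 < h) {n : ℕ} (hnT : n * h = T) (hQ : 1 ≤ Q) (hhQ : T / Q ≤ h)
    {x y : ℝ → V} (hx : SolutionBounds A M α T (T / Q) x) (hy : IsEulerPath A h n y)
    {s t : ℝ} (hs : 0 ≤ s) (hst : s ≤ t) (ht : t ≤ T) :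
    ‖x t - y t - (x s - y s)‖ ≤ 7 * Q * M * (t - s) ^ α := by
  have hQ0 : 0 < Q := by linarith
  have hN : 1 ≤ ⌈Q⌉₊ := Nat.one_le_ceil_iff.2 hQ0
  have hN1 : Q ≤ ⌈Q⌉₊ := Nat.le_ceil Q
  have hN2 : (⌈Q⌉₊ : ℝ) ≤ 2 * Q := by linarith [Nat.ceil_lt_add_one hQ0.le]
  have hnQ : (n : ℝ) ≤ Q := by
    rw [div_le_iff₀ hQ0, ← hnT, mul_comm (n : ℝ)] at hhQ
    exact le_of_mul_le_mul_left hhQ hh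
  have h1 := holder_of_local (f := x) hα (by positivity) hN
    (fun s t hs hst ht hd => hx.holder s t hs hst ht (hd.trans (by gcongr))) hs hst ht
  have h2 := hA.eulerPath_holder hα hM hh hnT hy hs hst ht
  have e : x t - y t - (x s - y s) = x t - x s - (y t - y s) := by abel
  have hts : 0 ≤ t - s := sub_nonneg.2 hst
  rw [e]
  calc _ ≤ _ := norm_sub_le _ _
    _ ≤ _ := add_le_add h1 h2
    _ = (2 * ⌈Q⌉₊ + 2 + n) * M * (t - s) ^ α := by ring
    _ ≤ _ := by
      gcongr
      linarith

end IsYoungDriver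

/-- Hölder bound for the error of the Euler scheme. -/
lemma exists_euler_error_holder {V : Type*} [NormedAddCommGroup V] [NormedSpace ℝ V]
    {α β T : ℝ} (hα : 1 < 2 * α) (hα1 : α < 1) (hβ : 0 < β) (hβ1 : β < 1)
    (hαβ : 1 < α * (1 + β)) (hT : 0 < T) :
    ∃ D B : ℝ, 0 ≤ D ∧ 0 ≤ B ∧
      ∀ (A : ℝ → V → V) (DA : ℝ → V → (V →L[ℝ] V)) (M Kx K : ℝ) (x y : ℝ → V) (n : ℕ),
        IsYoungDriver A DA M α β T →
        (∀ s t : ℝ, 0 ≤ s → s ≤ t → t ≤ T → ‖x t - x s‖ ≤ Kx * (t - s) ^ α) →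
        (∀ s t : ℝ, 0 ≤ s → s ≤ t → t ≤ T →
          ‖x t - x s - (A t (x s) - A s (x s))‖ ≤ K * (t - s) ^ (α * (1 + β))) →
        1 ≤ n → IsEulerPath A (T / n) n y → x 0 = y 0 →
        ∀ s t : ℝ, 0 ≤ s → s ≤ t → t ≤ T →
          ‖x t - y t - (x s - y s)‖ ≤ D * (1 + M) ^ 5 * Real.exp (B * (1 + M) ^ 2)
            * (n : ℝ) ^ (1 - 2 * α) * (t - s) ^ α := by
  have hc₁ := sewingConst_pos hα
  have hc₂ := sewingConst_pos hαβ
  obtain ⟨κ, hκ⟩ : ∃ κ, κ = 2 * sewingConst (2 * α) + 4 * sewingConst (α * (1 + β)) + 2 :=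
    ⟨_, rfl⟩
  have hκ0 : 0 ≤ κ := by rw [hκ]; positivity
  obtain ⟨b, hb⟩ : ∃ b, b = (1 + κ * T ^ α) ^ 2 := ⟨_, rfl⟩
  have hb1 : 1 ≤ b := by
    rw [hb]
    exact one_le_pow₀ (le_add_of_nonneg_right (by positivity))
  obtain ⟨d, hd⟩ : ∃ d, d = (8 * sewingConst (2 * α) + 4) * T ^ (1 - α)
      + (2 * sewingConst (α * (1 + β)) + 4) * (4 * sewingConst (2 * α)) * T ^ (1 - α) * T ^ α :=
    ⟨_, rfl⟩
  have hd0 : 0 ≤ d := by rw [hd]; positivity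
  refine ⟨2 * b * d * T ^ (2 * α - 1) * Real.exp 2 + 7 * b ^ 2, 4 * b, by positivity,
    by positivity, ?_⟩
  intro A DA M Kx K x y n hA hxK hxR hn hy hxy s t hs hst ht
  have hM := hA.nonneg hT
  have hn1 : (1 : ℝ) ≤ n := by exact_mod_cast hn
  have hn0 : (0 : ℝ) < n := by linarith
  have hh : 0 < T / n := by positivity
  have hnT : n * (T / n) = T := by field_simp
  have hts : 0 ≤ t - s := sub_nonneg.2 hst
  obtain ⟨Q, hQ⟩ : ∃ Q, Q = b * (1 + M) ^ 2 := ⟨_, rfl⟩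
  have hQ1 : 1 ≤ Q := by
    rw [hQ]
    exact one_le_mul_of_one_le_of_one_le hb1 (one_le_pow₀ (by linarith))
  have hΔ := IsYoungDriver.mul_div_rpow_le_one hα hT hM hκ0
    (show Q = ((1 + κ * T ^ α) * (1 + M)) ^ 2 by rw [hQ, hb]; ring)
  have hΔp : 0 ≤ M * (T / Q) ^ α := by positivity
  have hx := hA.solutionBounds hα hM hαβ hxK hxR (Δ := T / Q) (by nlinarith)
  have hrate : (n : ℝ) ^ (1 - 2 * α) = ((n : ℝ) ^ (2 * α - 1))⁻¹ := by
    rw [← Real.rpow_neg hn0.le]; congr 1; ring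
  set E := Real.exp (4 * b * (1 + M) ^ 2) with hE
  have hE1 : 1 ≤ E := Real.one_le_exp (by positivity)
  rcases le_total (T / n) (T / Q) with hhQ | hhQ
  · refine (hA.error_holder_fine hα hα1 hβ hβ1 hαβ hT hM hh hnT hQ1 hhQ hx hy hxy
      (by rw [← hκ]; exact hΔ) hs hst ht).trans ?_
    have e1 : Real.exp (4 * Q + 2) = E * Real.exp 2 := by
      rw [Real.exp_add, hE, hQ]; congr 2; ring
    rw [e1, ← hd, Real.div_rpow hT.le hn0.le, div_eq_mul_inv, ← hrate, hQ]
    calc _ = 2 * b * d * T ^ (2 * α - 1) * Real.exp 2 * (1 + M) ^ 5 * E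
          * (n : ℝ) ^ (1 - 2 * α) * (t - s) ^ α := by ring
      _ ≤ _ := by
        gcongr
        exact le_add_of_nonneg_right (by positivity)
  · refine (hA.error_holder_coarse (by linarith) hT hM hh hnT hQ1 hhQ hx hy hs hst ht).trans ?_
    have hnQ : (n : ℝ) ≤ Q := by
      rw [div_le_div_iff_of_pos_left hT (by linarith) hn0] at hhQ
      exact hhQ
    have h1 : 1 ≤ Q * (n : ℝ) ^ (1 - 2 * α) := by
      rw [hrate, ← div_eq_mul_inv, one_le_div (by positivity)]
      refine le_trans ?_ hnQ
      exact (Real.rpow_le_rpow_of_exponent_le hn1 (by linarith)).trans_eq (Real.rpow_one _)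
    calc 7 * Q * M * (t - s) ^ α
        ≤ 7 * Q * (1 + M) * (Q * (n : ℝ) ^ (1 - 2 * α)) * E * (t - s) ^ α := by
          refine mul_le_mul_of_nonneg_right ?_ (by positivity)
          have h2 : 7 * Q * M ≤ 7 * Q * (1 + M) := by gcongr; linarith
          refine h2.trans ?_
          rw [mul_assoc (7 * Q * (1 + M))]
          exact le_mul_of_one_le_right (by positivity) (one_le_mul_of_one_le_of_one_le h1 hE1)
      _ = 7 * b ^ 2 * (1 + M) ^ 5 * E * (n : ℝ) ^ (1 - 2 * α) * (t - s) ^ α := by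
          rw [hQ]; ring
      _ ≤ _ := by
        gcongr
        exact le_add_of_nonneg_left (by positivity)

/-- **Rate of convergence of the Euler scheme.**  Let `α(1+β) > 1`, `A ∈ C^α_t C^{1+β}_V` and
`x₀ ∈ V`.  Let `xe n` be the `n`-step Euler path on the uniform grid `t^n_k = kT/n` and `x`
the unique solution of `x_t = x₀ + ∫_0^t A(ds,x_s)`.  Then
`‖x - xe n‖_α ≤ C exp(C ‖A‖_{α,1+β}^6) n^{1-2α}` with `C = C(α,β,T)`. -/
theorem euler_scheme_rate
    {V : Type*} [NormedAddCommGroup V] [NormedSpace ℝ V] [CompleteSpace V]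
    (α β : ℝ) (hα0 : 0 < α) (hα1 : α < 1) (hβ0 : 0 < β) (hβ1 : β < 1)
    (hαβ : 1 < α * (1 + β)) (T : ℝ) (hT : 0 < T) :
    ∃ C : ℝ, 0 ≤ C ∧
      ∀ (A : ℝ → V → V) (DA : ℝ → V → (V →L[ℝ] V)) (MA : ℝ) (x₀ : V)
        (x : ℝ → V) (xe : ℕ → ℝ → V) (Kx K : ℝ),
        (∀ z : V, A 0 z = 0) →
        (∀ t : ℝ, ∀ z : V, 0 ≤ t → t ≤ T → HasFDerivAt (A t) (DA t z) z) →
        (∀ s t : ℝ, ∀ z : V, 0 ≤ s → s ≤ t → t ≤ T →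
          ‖A t z - A s z‖ ≤ MA * (t - s) ^ α) →
        (∀ s t : ℝ, ∀ z w : V, 0 ≤ s → s ≤ t → t ≤ T →
          ‖A t z - A s z - (A t w - A s w)‖ ≤ MA * (t - s) ^ α * ‖z - w‖ ^ β) →
        (∀ s t : ℝ, ∀ z : V, 0 ≤ s → s ≤ t → t ≤ T →
          ‖DA t z - DA s z‖ ≤ MA * (t - s) ^ α) →
        (∀ s t : ℝ, ∀ z w : V, 0 ≤ s → s ≤ t → t ≤ T →
          ‖DA t z - DA s z - (DA t w - DA s w)‖ ≤ MA * (t - s) ^ α * ‖z - w‖ ^ β) →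
        -- x is the solution of the YDE
        x 0 = x₀ →
        (∀ s t : ℝ, 0 ≤ s → s ≤ t → t ≤ T → ‖x t - x s‖ ≤ Kx * (t - s) ^ α) →
        (∀ s t : ℝ, 0 ≤ s → s ≤ t → t ≤ T →
          ‖x t - x s - (A t (x s) - A s (x s))‖ ≤ K * (t - s) ^ (α * (1 + β))) →
        -- xe n is the n-step Euler path
        (∀ n : ℕ, 1 ≤ n → xe n 0 = x₀) →
        (∀ n : ℕ, 1 ≤ n → ∀ k : ℕ, k < n → ∀ t : ℝ,
          (k : ℝ) * T / n ≤ t → t ≤ ((k : ℝ) + 1) * T / n →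
          xe n t = xe n ((k : ℝ) * T / n) +
            (A t (xe n ((k : ℝ) * T / n)) - A ((k : ℝ) * T / n) (xe n ((k : ℝ) * T / n)))) →
        ∀ n : ℕ, 1 ≤ n →
          (∀ t : ℝ, 0 ≤ t → t ≤ T →
            ‖x t - xe n t‖ ≤
              C * Real.exp (C * MA ^ 6) * (n : ℝ) ^ ((1 : ℝ) - 2 * α)) ∧
          (∀ s t : ℝ, 0 ≤ s → s ≤ t → t ≤ T →
            ‖(x t - xe n t) - (x s - xe n s)‖ ≤
              C * Real.exp (C * MA ^ 6) * (n : ℝ) ^ ((1 : ℝ) - 2 * α) * (t - s) ^ α) := by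
  have hα : 1 < 2 * α := by nlinarith
  obtain ⟨D, B, hD, hB, hDB⟩ := exists_euler_error_holder (V := V) hα hα1 hβ0 hβ1 hαβ hT
  have hTα : 0 ≤ T ^ α := by positivity
  obtain ⟨C, hC, hCM⟩ := exists_mul_exp_pow_six_bound (D * (1 + T ^ α)) B (by positivity) hB
  refine ⟨C, hC, ?_⟩
  intro A DA MA x₀ x xe Kx K _ hDA hA1 _ hDA1 hDA2 hx0 hxK hxR hxe0 hxe n hn
  have hA : IsYoungDriver A DA MA α β T :=
    { hasFDerivAt := hDA
      norm_increment_le := hA1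
      norm_deriv_le := hDA1
      norm_deriv_sub_le := hDA2 }
  have hM := hA.nonneg hT
  have hy : IsEulerPath A (T / n) n (xe n) := fun k hk t h1 h2 => by
    simpa only [mul_div_assoc] using hxe n hn k hk t (by rwa [mul_div_assoc])
      (by rwa [mul_div_assoc])
  have key := hDB A DA MA Kx K x (xe n) n hA hxK hxR hn hy (hx0.trans (hxe0 n hn).symm)
  set F := D * (1 + MA) ^ 5 * Real.exp (B * (1 + MA) ^ 2) with hF
  have hF0 : 0 ≤ F := by positivity
  have hFC : F * (1 + T ^ α) ≤ C * Real.exp (C * MA ^ 6) :=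
    le_of_eq_of_le (by rw [hF]; ring) (hCM MA hM)
  refine ⟨fun t ht0 ht => ?_, fun s t hs hst ht => ?_⟩
  · have h1 := key 0 t le_rfl ht0 ht
    rw [hx0, hxe0 n hn, sub_self, sub_zero, sub_zero] at h1
    calc _ ≤ _ := h1
      _ ≤ F * (n : ℝ) ^ (1 - 2 * α) * T ^ α := by gcongr
      _ = F * T ^ α * (n : ℝ) ^ (1 - 2 * α) := by ring
      _ ≤ _ := by
        refine mul_le_mul_of_nonneg_right ?_ (by positivity)
        linarith
  · have hts : 0 ≤ t - s := sub_nonneg.2 hst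
    refine (key s t hs hst ht).trans ?_
    gcongr
    linarith [mul_nonneg hF0 hTα]
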